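/- Let L be an integral ℓ-monoid, let α be a fuzzy regular expression over a finite alphabet X with associated alphabet Y, let A = (A, X∪Y, δ^A, a₀, τ^A) be an arbitrary nondeterministic finite automaton recognizing ‖α_R‖, and let A_α be the fuzzy automaton associated with A and α. Then every right invariant crisp equivalence E on the nondeterministic automaton A is a right invariant crisp equivalence on the fuzzy automaton A_α (i.e., E∘δ^{A_α}_x ≤ δ^{A_α}_x∘E for every x ∈ X and E∘τ^{A_α} = τ^{A_α}), and the identity map on A/E is an isomorphism from the fuzzy automaton (A/E)_α associated with A/E and α onto the factor fuzzy automaton A_α/E: δ_x^{(A/E)_α}(E_a, E_b) = δ_x^{A_α/E}(E_a, E_b) for all x ∈ X and a, b ∈ A, and τ^{(A/E)_α}(E_a) = τ^{A_α/E}(E_a) for all a ∈ A. -/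

import Mathlib

attribute [local instance] Classical.propDecidable

/-- A lattice-ordered monoid (ℓ-monoid): a lattice with least element `⊥` and greatest
element `⊤`, together with a monoid structure (multiplication `*`, unit `1`, playing the
role of `e`) such that `⊥` (playing the role of the scalar `0`) is absorbing and
multiplication distributes over binary joins on both sides. -/
class LMonoid (L : Type*) extends Lattice L, BoundedOrder L, Monoid L where
  mul_bot : ∀ x : L, x * ⊥ = ⊥
  bot_mul : ∀ x : L, ⊥ * x = ⊥
  mul_sup : ∀ x y z : L, x * (y ⊔ z) = x * y ⊔ x * z
  sup_mul : ∀ x y z : L, (x ⊔ y) * z = x * z ⊔ y * z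

/-- An integral ℓ-monoid: the unit of the multiplication is the top element of the lattice. -/
class IntegralLMonoid (L : Type*) extends LMonoid L where
  one_eq_top : (1 : L) = ⊤

/-- Fuzzy regular expressions over an alphabet `X` with scalars in `L`. -/
inductive FRE (X L : Type*) where
  | zero : FRE X L
  | eps : FRE X L
  | char : X → FRE X L
  | smul : L → FRE X L → FRE X L
  | plus : FRE X L → FRE X L → FRE X L
  | comp : FRE X L → FRE X L → FRE X L
  | star : FRE X L → FRE X L

/-- The set of scalars of `L` occurring in a fuzzy regular expression. -/
def FRE.scalars {X L : Type*} : FRE X L → Set L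
  | .zero => ∅
  | .eps => ∅
  | .char _ => ∅
  | .smul lam β => insert lam β.scalars
  | .plus β γ => β.scalars ∪ γ.scalars
  | .comp β γ => β.scalars ∪ γ.scalars
  | .star β => β.scalars

noncomputable section

namespace Fz

variable {L : Type*} [IntegralLMonoid L]

/-- Composition of fuzzy relations: `(R ∘ S)(a,b) = ⋁_{c} R(a,c) ⊗ S(c,b)`. -/
def fcomp {A : Type*} [Fintype A] (R S : A → A → L) : A → A → L :=
  fun a b => Finset.univ.sup fun c => R a c * S c b

/-- Composition of a fuzzy relation with a fuzzy set: `(R ∘ f)(a) = ⋁_{b} R(a,b) ⊗ f(b)`. -/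
def fcompf {A : Type*} [Fintype A] (R : A → A → L) (f : A → L) : A → L :=
  fun a => Finset.univ.sup fun b => R a b * f b

/-- Composition of a fuzzy set with a fuzzy relation: `(f ∘ R)(a) = ⋁_{b} f(b) ⊗ R(b,a)`. -/
def fcompfR {A : Type*} [Fintype A] (f : A → L) (R : A → A → L) : A → L :=
  fun a => Finset.univ.sup fun b => f b * R b a

/-- Powers of a fuzzy relation: `R⁰` is the crisp equality and `R^{k+1} = R^k ∘ R`. -/
def rpow {A : Type*} [Fintype A] (R : A → A → L) : ℕ → A → A → L
  | 0 => fun a b => if a = b then 1 else ⊥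
  | k + 1 => fcomp (rpow R k) R

private def dstarAux {A Z : Type*} [Fintype A] (δ : A → Z → A → L) : A → List Z → A → L
  | a, [], b => if a = b then 1 else ⊥
  | a, z :: w, b => Finset.univ.sup fun c => dstarAux δ a w c * δ c z b

/-- The extension of a fuzzy transition relation to words:
`δ(a, ε, b) = 1` if `a = b` and `⊥` otherwise, and
`δ(a, ux, b) = ⋁_{c} δ(a, u, c) ⊗ δ(c, x, b)`. -/
def dstar {A Z : Type*} [Fintype A] (δ : A → Z → A → L) (a : A) (w : List Z) (b : A) : L :=
  dstarAux δ a w.reverse b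

/-- Fuzzy language recognized by a fuzzy automaton with a single crisp initial state `a0`:
`L(A)(u) = ⋁_{b} δ(a0, u, b) ⊗ τ(b)`. -/
def lang {A Z : Type*} [Fintype A] (δ : A → Z → A → L) (a0 : A) (τ : A → L)
    (w : List Z) : L :=
  Finset.univ.sup fun b => dstar δ a0 w b * τ b

/-- Concatenation of fuzzy languages: `(fg)(u) = ⋁_{u = vw} f(v) ⊗ g(w)`
(a finite join over the factorizations of `u`). -/
def fconcat {X : Type*} (f g : List X → L) : List X → L :=
  fun u => (Finset.range (u.length + 1)).sup fun i => f (u.take i) * g (u.drop i)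

/-- Powers of a fuzzy language: `f⁰` is the characteristic function of the empty word,
and `f^{n+1} = fⁿ f`. -/
def fpow {X : Type*} (f : List X → L) : ℕ → List X → L
  | 0 => fun u => if u = [] then 1 else ⊥
  | n + 1 => fconcat (fpow f n) f

/-- `IsNorm α f` asserts that `f` is the fuzzy language `‖α‖` represented by the fuzzy
regular expression `α` (for the star, `‖β*‖(u)` is the least upper bound of the powers,
which is required to exist). -/
inductive IsNorm {X : Type*} : FRE X L → (List X → L) → Prop
  | zero : IsNorm .zero fun _ => ⊥
  | eps : IsNorm .eps fun u => if u = [] then 1 else ⊥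
  | char (x : X) : IsNorm (.char x) fun u => if u = [x] then 1 else ⊥
  | smul (lam : L) {β : FRE X L} {f : List X → L} :
      IsNorm β f → IsNorm (.smul lam β) fun u => lam * f u
  | plus {β γ : FRE X L} {f g : List X → L} :
      IsNorm β f → IsNorm γ g → IsNorm (.plus β γ) fun u => f u ⊔ g u
  | comp {β γ : FRE X L} {f g : List X → L} :
      IsNorm β f → IsNorm γ g → IsNorm (.comp β γ) (fconcat f g)
  | star {β : FRE X L} {f g : List X → L} :
      IsNorm β f → (∀ u, IsLUB {l | ∃ n : ℕ, l = fpow f n u} (g u)) →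
      IsNorm (.star β) g

/-- The ordinary regular expression `α_R` over `X ∪ Y` obtained from a fuzzy regular
expression `α` by replacing each scalar `λ` by the associated letter `λ' = sc λ ∈ Y`. -/
def toReg {X Y : Type*} (sc : L → Y) : FRE X L → RegularExpression (X ⊕ Y)
  | .zero => 0
  | .eps => 1
  | .char x => RegularExpression.char (Sum.inl x)
  | .smul lam β => RegularExpression.char (Sum.inr (sc lam)) * toReg sc β
  | .plus β γ => toReg sc β + toReg sc γ
  | .comp β γ => toReg sc β * toReg sc γ
  | .star β => (toReg sc β).star

/-- `U_Y(u)`: the set of words over `X ∪ Y` from which deleting all letters of `Y`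
yields `u` (the shuffle of `u` with `Y*`). -/
def UY {X : Type*} (Y : Type*) (u : List X) : Set (List (X ⊕ Y)) :=
  {v | v.filterMap (fun z => z.getLeft?) = u}

/-- The homomorphism `φ*_α : (X ∪ Y)* → (L, ⊗, 1)` determined by mapping every letter of
`X` to `1` and every letter `λ' ∈ Y` to the corresponding scalar `λ = φY λ'`. -/
def phiStar {X Y : Type*} (φY : Y → L) (v : List (X ⊕ Y)) : L :=
  (v.map (Sum.elim (fun _ => (1 : L)) φY)).prod

/-- The language `‖α_R‖` of the regular expression `α_R`, viewed as a fuzzy language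
with membership values in `{0, 1} ⊆ L`. -/
def langR {X Y : Type*} (sc : L → Y) (α : FRE X L) (v : List (X ⊕ Y)) : L :=
  if v ∈ (toReg sc α).matches' then 1 else ⊥

/-- The reflexive fuzzy relation `R` on the state set of a nondeterministic automaton over
`X ∪ Y`: `R(a,a) = 1` and, for `a ≠ b`, `R(a,b) = ⋁_{λ' ∈ Y} λ ⊗ δ(a, λ', b)`. -/
def Rstep {X Y A : Type*} [Fintype A] [Fintype Y] (φY : Y → L)
    (δ : A → X ⊕ Y → A → L) : A → A → L :=
  fun a b => if a = b then 1 else Finset.univ.sup fun y : Y => φY y * δ a (Sum.inr y) b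

/-- The fuzzy relation `R_A = Rⁿ`, `n = |A|`: the least transitive fuzzy relation
containing `R`. -/
def RA {X Y A : Type*} [Fintype A] [Fintype Y] (φY : Y → L)
    (δ : A → X ⊕ Y → A → L) : A → A → L :=
  rpow (Rstep φY δ) (Fintype.card A)

/-- The set `{φ*_α(v) ⊗ δ^A(a,v,b) : v ∈ U_Y(x)}` whose least upper bound defines the
transition `δ^{A_α}(a, x, b)` of the fuzzy automaton associated with `A` and `α`. -/
def dset {X Y A : Type*} [Fintype A] (φY : Y → L) (δ : A → X ⊕ Y → A → L)
    (a : A) (x : X) (b : A) : Set L :=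
  {l | ∃ v ∈ UY Y [x], l = phiStar φY v * dstar δ a v b}

/-- The set `{⋁_{b} φ*_α(v) ⊗ δ^A(a,v,b) ⊗ τ(b) : v ∈ Y*}` whose least upper bound defines
the terminal degree `τ^{A_α}(a)` of the fuzzy automaton associated with `A` and `α`. -/
def tset {X Y A : Type*} [Fintype A] (φY : Y → L) (δ : A → X ⊕ Y → A → L)
    (τ : A → L) (a : A) : Set L :=
  {l | ∃ w : List Y, l = Finset.univ.sup fun b =>
    phiStar φY ((w.map Sum.inr : List (X ⊕ Y))) *
      dstar δ a (w.map Sum.inr) b * τ b}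


/-- The setoid on the state set induced by a crisp equivalence `E`
(`a ≈ b` iff `E(a,b) = 1`). -/
def toSetoid {A : Type*} (E : A → A → L) (hrefl : ∀ a, E a a = 1)
    (hsymm : ∀ a b, E a b = E b a) (htrans : ∀ a b c, E a b * E b c ≤ E a c) :
    Setoid A where
  r a b := E a b = 1
  iseqv := by
    refine ⟨fun a => hrefl a, fun {a b} h => by rw [hsymm]; exact h, fun {a b c} h1 h2 => ?_⟩
    refine le_antisymm ?_ ?_
    · rw [IntegralLMonoid.one_eq_top (L := L)]; exact le_top
    · calc (1 : L) = 1 * 1 := (one_mul 1).symm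
      _ = E a b * E b c := by rw [h1, h2]
      _ ≤ E a c := htrans a b c

theorem erow {A : Type*} {E : A → A → L} (hsymm : ∀ a b, E a b = E b a)
    (htrans : ∀ a b c, E a b * E b c ≤ E a c) {a a' : A} (h : E a a' = 1) (c : A) :
    E a c = E a' c := by
  apply le_antisymm
  · have h' : E a' a = 1 := by rw [hsymm]; exact h
    calc E a c = E a' a * E a c := by rw [h', one_mul]
    _ ≤ E a' c := htrans a' a c
  · calc E a' c = E a a' * E a' c := by rw [h, one_mul]
    _ ≤ E a c := htrans a a' c

theorem sandwich_congr {A : Type*} [Fintype A] {E : A → A → L}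
    (hsymm : ∀ a b, E a b = E b a) (htrans : ∀ a b c, E a b * E b c ≤ E a c)
    (M : A → A → L) {a a' b b' : A} (ha : E a a' = 1) (hb : E b b' = 1) :
    fcomp (fcomp E M) E a b = fcomp (fcomp E M) E a' b' := by
  simp only [fcomp]
  have h1 : ∀ c, (Finset.univ.sup fun d => E a d * M d c) =
      Finset.univ.sup fun d => E a' d * M d c :=
    fun c => Finset.sup_congr rfl fun d _ => by rw [erow hsymm htrans ha d]
  have h2 : ∀ c, E c b = E c b' := fun c => by
    rw [hsymm c b, erow hsymm htrans hb c, hsymm b' c]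
  exact Finset.sup_congr rfl fun c _ => by rw [h1 c, h2 c]

/-- The fuzzy transition relation of the factor automaton `A/E`:
`δ^{A/E}(E_a, z, E_b) = (E ∘ δ_z ∘ E)(a, b)`. -/
def deltaQ {A Z : Type*} [Fintype A] (E : A → A → L) (hrefl : ∀ a, E a a = 1)
    (hsymm : ∀ a b, E a b = E b a) (htrans : ∀ a b c, E a b * E b c ≤ E a c)
    (δ : A → Z → A → L) :
    Quotient (toSetoid E hrefl hsymm htrans) → Z →
      Quotient (toSetoid E hrefl hsymm htrans) → L :=
  fun p z q =>
    Quotient.lift₂ (fun a b => fcomp (fcomp E (fun c d => δ c z d)) E a b)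
      (fun _ _ _ _ ha hb => sandwich_congr hsymm htrans _ ha hb) p q

/-- The terminal fuzzy set of the factor automaton `A/E`: `τ^{A/E}(E_a) = (τ^A ∘ E)(a)`. -/
def tauQ {A : Type*} [Fintype A] (E : A → A → L) (hrefl : ∀ a, E a a = 1)
    (hsymm : ∀ a b, E a b = E b a) (htrans : ∀ a b c, E a b * E b c ≤ E a c)
    (τ : A → L) : Quotient (toSetoid E hrefl hsymm htrans) → L :=
  Quotient.lift (fun a => fcompfR τ E a)
    (fun a a' h => by
      simp only [fcompfR]
      exact Finset.sup_congr rfl fun b _ => by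
        rw [hsymm b a, erow hsymm htrans h b, hsymm a' b])

end Fz

end

namespace Fz

section helpers
variable {L : Type*} [IntegralLMonoid L]

theorem h_mul_mono {a b c d : L} (h : a ≤ b) (h2 : c ≤ d) : a * c ≤ b * d := by
  have h1 : a * c ≤ b * c := by
    rw [← sup_eq_right.mpr h, LMonoid.sup_mul]; exact le_sup_left
  have h3 : b * c ≤ b * d := by
    rw [← sup_eq_right.mpr h2, LMonoid.mul_sup]; exact le_sup_left
  exact h1.trans h3

theorem h_mul_fsup {ι : Type*} (s : Finset ι) (a : L) (f : ι → L) :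
    a * s.sup f = s.sup fun i => a * f i := by
  classical
  induction s using Finset.induction_on with
  | empty => simp [LMonoid.mul_bot]
  | insert i s hi ih => simp only [Finset.sup_insert, LMonoid.mul_sup, ih]

theorem h_fsup_mul {ι : Type*} (s : Finset ι) (a : L) (f : ι → L) :
    s.sup f * a = s.sup fun i => f i * a := by
  classical
  induction s using Finset.induction_on with
  | empty => simp [LMonoid.bot_mul]
  | insert i s hi ih => simp only [Finset.sup_insert, LMonoid.sup_mul, ih]

variable {A : Type*} [Fintype A]

theorem h_le_usup {f : A → L} (i : A) {l : L} (h : l ≤ f i) : l ≤ Finset.univ.sup f :=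
  h.trans (Finset.le_sup (f := f) (Finset.mem_univ i))

theorem h_assoc (R S T : A → A → L) : fcomp (fcomp R S) T = fcomp R (fcomp S T) := by
  funext a b
  simp only [fcomp, h_fsup_mul, h_mul_fsup, mul_assoc]
  exact Finset.sup_comm _ _ _

theorem h_mono {R R' S S' : A → A → L} (h : R ≤ R') (h2 : S ≤ S') :
    fcomp R S ≤ fcomp R' S' := fun a b =>
  Finset.sup_mono_fun fun c _ => h_mul_mono (h a c) (h2 c b)

theorem h_dstar_snoc {Z : Type*} (δ : A → Z → A → L) (w : List Z) (z : Z) :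
    (fun a b => dstar δ a (w ++ [z]) b) =
      fcomp (fun a b => dstar δ a w b) (fun a b => δ a z b) := by
  funext a b
  simp [dstar, dstarAux, fcomp]

theorem h_dstar_nil {Z : Type*} (δ : A → Z → A → L) (a b : A) :
    dstar δ a [] b = if a = b then 1 else ⊥ := by
  simp [dstar, dstarAux]

theorem h_le_comp_refl {E : A → A → L} (hrefl : ∀ a, E a a = 1) (R : A → A → L) :
    R ≤ fcomp R E := fun a b => h_le_usup b (by simp [hrefl])

theorem h_le_refl_comp {E : A → A → L} (hrefl : ∀ a, E a a = 1) (R : A → A → L) :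
    R ≤ fcomp E R := fun a b => h_le_usup a (by simp [hrefl])

theorem h_idem {E : A → A → L} (hrefl : ∀ a, E a a = 1)
    (htrans : ∀ a b c, E a b * E b c ≤ E a c) : fcomp E E = E :=
  le_antisymm (fun a b => Finset.sup_le fun c _ => htrans a c b) (h_le_comp_refl hrefl E)

theorem h_id_left (f : A → L) (a : A) :
    (Finset.univ.sup fun c => (if a = c then (1 : L) else ⊥) * f c) = f a := by
  apply le_antisymm
  · refine Finset.sup_le fun c _ => ?_
    by_cases h : a = c
    · simp [h]
    · simp [h, LMonoid.bot_mul]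
  · exact h_le_usup a (by simp)

theorem h_id_right (f : A → L) (b : A) :
    (Finset.univ.sup fun c => f c * (if c = b then (1 : L) else ⊥)) = f b := by
  apply le_antisymm
  · refine Finset.sup_le fun c _ => ?_
    by_cases h : c = b
    · simp [h]
    · simp [h, LMonoid.mul_bot]
  · exact h_le_usup b (by simp)

theorem h_dstar_rinv {Z : Type*} (δ : A → Z → A → L) (E : A → A → L)
    (hrinv : ∀ z, fcomp E (fun p q => δ p z q) ≤ fcomp (fun p q => δ p z q) E) (w : List Z) :
    fcomp E (fun a b => dstar δ a w b) ≤ fcomp (fun a b => dstar δ a w b) E := by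
  induction w using List.reverseRecOn with
  | nil =>
    intro a b
    simp only [fcomp, h_dstar_nil]
    rw [h_id_left (fun c => E c b), h_id_right (fun c => E a c)]
  | append_singleton w z ih =>
    rw [h_dstar_snoc, ← h_assoc]
    refine (h_mono ih le_rfl).trans ?_
    rw [h_assoc, h_assoc]
    exact h_mono le_rfl (hrinv z)

theorem h_qsup {s : Setoid A} [Fintype (Quotient s)] (f : Quotient s → L) :
    Finset.univ.sup f = Finset.univ.sup fun a => f (Quotient.mk s a) := by
  apply le_antisymm
  · refine Finset.sup_le fun q _ => ?_
    induction q using Quotient.inductionOn with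
    | h a => exact h_le_usup a le_rfl
  · exact Finset.sup_le fun a _ => h_le_usup (Quotient.mk s a) le_rfl

theorem h_dstarQ {Z : Type*} (δ : A → Z → A → L) (E : A → A → L)
    (hcrisp : ∀ a b, E a b = 1 ∨ E a b = ⊥)
    (hrefl : ∀ a, E a a = 1) (hsymm : ∀ a b, E a b = E b a)
    (htrans : ∀ a b c, E a b * E b c ≤ E a c)
    (hrinv : ∀ z, fcomp E (fun p q => δ p z q) ≤ fcomp (fun p q => δ p z q) E) (w : List Z) :
    (fun a b => dstar (deltaQ E hrefl hsymm htrans δ)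
      (Quotient.mk (toSetoid E hrefl hsymm htrans) a) w
      (Quotient.mk (toSetoid E hrefl hsymm htrans) b)) =
    fcomp (fun a b => dstar δ a w b) E := by
  induction w using List.reverseRecOn with
  | nil =>
    funext a b
    simp only [fcomp, h_dstar_nil]
    rw [h_id_left (fun c => E c b)]
    have hiff : (Quotient.mk (toSetoid E hrefl hsymm htrans) a =
        Quotient.mk (toSetoid E hrefl hsymm htrans) b) ↔ E a b = 1 := Quotient.eq
    by_cases h : E a b = 1
    · rw [if_pos (hiff.mpr h), h]
    · rw [if_neg (fun h' => h (hiff.mp h'))]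
      exact ((hcrisp a b).resolve_left h).symm
  | append_singleton w z ih =>
    have step : (fun a b => dstar (deltaQ E hrefl hsymm htrans δ)
        (Quotient.mk (toSetoid E hrefl hsymm htrans) a) (w ++ [z])
        (Quotient.mk (toSetoid E hrefl hsymm htrans) b)) =
        fcomp (fcomp (fun a b => dstar δ a w b) E)
          (fcomp (fcomp E (fun c d => δ c z d)) E) := by
      rw [← ih]
      funext a b
      have := congrFun (congrFun (h_dstar_snoc (deltaQ E hrefl hsymm htrans δ) w z)
        (Quotient.mk (toSetoid E hrefl hsymm htrans) a))
        (Quotient.mk (toSetoid E hrefl hsymm htrans) b)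
      refine this.trans ?_
      unfold fcomp
      rw [h_qsup]
      rfl
    have key : fcomp (fcomp E (fun c d => δ c z d)) E = fcomp (fun c d => δ c z d) E := by
      apply le_antisymm
      · refine (h_mono (hrinv z) le_rfl).trans ?_
        rw [h_assoc, h_idem hrefl htrans]
      · exact h_mono (h_le_refl_comp hrefl _) le_rfl
    rw [step, key, h_assoc, ← h_assoc E, key, h_dstar_snoc, h_assoc]

end helpers

end Fz

open Fz in
/-- **Theorem 9 of the paper.** Let `L` be an integral ℓ-monoid, `α` a
fuzzy regular expression over a finite alphabet `X` with associated alphabet `Y`,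
`A = (A, X∪Y, δ, a₀, τ)` an arbitrary nondeterministic finite automaton recognizing
`‖α_R‖`, and `A_α` the fuzzy automaton associated with `A` and `α` (transitions `δα`,
terminal fuzzy set `τα`).  Then every right invariant crisp equivalence `E` on `A` is a
right invariant crisp equivalence on `A_α`, and the identity map on `A/E` is an
isomorphism from the fuzzy automaton `(A/E)_α` (transitions `δαQ`, terminal set `ταQ`)
associated with the factor automaton `A/E` and `α` onto the factor fuzzy automaton
`A_α/E`:  `δ_x^{(A/E)_α}(E_a, E_b) = δ_x^{A_α/E}(E_a, E_b) = (E ∘ δα_x ∘ E)(a,b)` and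
`τ^{(A/E)_α}(E_a) = τ^{A_α/E}(E_a) = (τα ∘ E)(a)`. -/
theorem stmt17 {L X Y A : Type*} [IntegralLMonoid L] [Fintype X] [Fintype Y] [Fintype A]
    (α : FRE X L) (sc : L → Y) (φY : Y → L)
    (hsc : Set.BijOn sc α.scalars (Set.univ : Set Y))
    (hφY : ∀ l ∈ α.scalars, φY (sc l) = l)
    (δ : A → X ⊕ Y → A → L) (a0 : A) (τ : A → L)
    (hδ : ∀ a z b, δ a z b = 1 ∨ δ a z b = ⊥)
    (hτ : ∀ a, τ a = 1 ∨ τ a = ⊥)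
    (hrec : ∀ v : List (X ⊕ Y), lang δ a0 τ v = langR sc α v)
    (E : A → A → L)
    (hcrisp : ∀ a b, E a b = 1 ∨ E a b = ⊥)
    (hrefl : ∀ a, E a a = 1) (hsymm : ∀ a b, E a b = E b a)
    (htrans : ∀ a b c, E a b * E b c ≤ E a c)
    (hrinv : ∀ (z : X ⊕ Y) (a b : A),
      fcomp E (fun p q => δ p z q) a b ≤ fcomp (fun p q => δ p z q) E a b)
    (hτinv : ∀ a, fcompf E τ a = τ a)
    -- the fuzzy automaton `A_α` associated with `A` and `α`
    (δα : A → X → A → L) (τα : A → L)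
    (hδα : ∀ (a : A) (x : X) (b : A), IsLUB (dset φY δ a x b) (δα a x b))
    (hτα : ∀ a : A, IsLUB (tset φY δ τ a) (τα a))
    -- the fuzzy automaton `(A/E)_α` associated with the factor automaton `A/E` and `α`
    (δαQ : Quotient (toSetoid E hrefl hsymm htrans) → X →
      Quotient (toSetoid E hrefl hsymm htrans) → L)
    (ταQ : Quotient (toSetoid E hrefl hsymm htrans) → L)
    (hδαQ : ∀ (p : Quotient (toSetoid E hrefl hsymm htrans)) (x : X)
      (q : Quotient (toSetoid E hrefl hsymm htrans)),
      IsLUB (dset φY (deltaQ E hrefl hsymm htrans δ) p x q) (δαQ p x q))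
    (hταQ : ∀ p : Quotient (toSetoid E hrefl hsymm htrans),
      IsLUB (tset φY (deltaQ E hrefl hsymm htrans δ) (tauQ E hrefl hsymm htrans τ) p)
        (ταQ p)) :
    -- `E` is right invariant on `A_α`:
    (∀ (x : X) (a b : A),
      fcomp E (fun p q => δα p x q) a b ≤ fcomp (fun p q => δα p x q) E a b) ∧
    (∀ a : A, fcompf E τα a = τα a) ∧
    -- the identity on `A/E` is an isomorphism from `(A/E)_α` onto `A_α/E`:
    (∀ (x : X) (a b : A),
      δαQ (Quotient.mk (toSetoid E hrefl hsymm htrans) a) x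
          (Quotient.mk (toSetoid E hrefl hsymm htrans) b) =
        fcomp (fcomp E (fun p q => δα p x q)) E a b) ∧
    (∀ a : A,
      ταQ (Quotient.mk (toSetoid E hrefl hsymm htrans) a) = fcompfR τα E a) := by
  have hE : ∀ z, fcomp E (fun p q => δ p z q) ≤ fcomp (fun p q => δ p z q) E :=
    fun z a b => hrinv z a b
  have hD := h_dstar_rinv δ E hE
  have hQ := h_dstarQ δ E hcrisp hrefl hsymm htrans hE
  have hQ' : ∀ w a b, dstar (deltaQ E hrefl hsymm htrans δ)
      (Quotient.mk (toSetoid E hrefl hsymm htrans) a) w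
      (Quotient.mk (toSetoid E hrefl hsymm htrans) b) =
      fcomp (fun a b => dstar δ a w b) E a b := fun w a b => congrFun (congrFun (hQ w) a) b
  -- each approximant composed with `E` lies below the composed transition
  have hlow : ∀ (x : X) (a b : A) (v : List (X ⊕ Y)), v ∈ UY Y [x] →
      phiStar φY v * fcomp (fun a b => dstar δ a v b) E a b ≤
        fcomp (fun p q => δα p x q) E a b := by
    intro x a b v hv
    unfold fcomp
    rw [h_mul_fsup]
    refine Finset.sup_mono_fun fun d _ => ?_
    rw [← mul_assoc]
    exact h_mul_mono ((hδα a x d).1 ⟨v, hv, rfl⟩) le_rfl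
  have hone : ∀ (w : List (X ⊕ Y)) (a c b : A), E a c = 1 →
      dstar δ c w b ≤ fcomp (fun a b => dstar δ a w b) E a b := by
    intro w a c b h
    refine le_trans ?_ (hD w a b)
    exact h_le_usup c (by simp [h])
  have hrin : ∀ x : X, fcomp E (fun p q => δα p x q) ≤ fcomp (fun p q => δα p x q) E := by
    intro x a b
    refine Finset.sup_le fun c _ => ?_
    rcases hcrisp a c with h | h
    · rw [h, one_mul]
      refine (hδα c x b).2 ?_
      rintro l ⟨v, hv, rfl⟩
      exact (h_mul_mono le_rfl (hone v a c b h)).trans (hlow x a b v hv)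
    · rw [h, LMonoid.bot_mul]; exact bot_le
  have hEτ : ∀ d b, E d b * τ b ≤ τ d := by
    intro d b
    conv_rhs => rw [← hτinv d]
    exact h_le_usup b le_rfl
  have hDEτ : ∀ (w : List (X ⊕ Y)) (l : L) (a b : A),
      l * fcomp (fun a b => dstar δ a w b) E a b * τ b ≤
        Finset.univ.sup fun d => l * dstar δ a w d * τ d := by
    intro w l a b
    unfold fcomp
    rw [h_mul_fsup, h_fsup_mul]
    refine Finset.sup_mono_fun fun d _ => ?_
    simp only [mul_assoc]
    exact h_mul_mono le_rfl (h_mul_mono le_rfl (hEτ d b))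
  have hτmono : ∀ a c, E a c = 1 → τα c ≤ τα a := by
    intro a c h
    refine (hτα c).2 ?_
    rintro l ⟨w, rfl⟩
    refine le_trans ?_ ((hτα a).1 ⟨w, rfl⟩)
    refine Finset.sup_le fun b _ => ?_
    exact (h_mul_mono (h_mul_mono le_rfl (hone _ a c b h)) le_rfl).trans (hDEτ _ _ a b)
  have hτQ : ∀ b, tauQ E hrefl hsymm htrans τ
      (Quotient.mk (toSetoid E hrefl hsymm htrans) b) = τ b := by
    intro b
    rw [← hτinv b]
    change (Finset.univ.sup fun c => τ c * E c b) = Finset.univ.sup fun c => E b c * τ c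
    refine Finset.sup_congr rfl fun c _ => ?_
    rw [hsymm c b]
    rcases hcrisp b c with h | h <;> simp [h, LMonoid.bot_mul, LMonoid.mul_bot]
  refine ⟨hrin, ?_, ?_, ?_⟩
  · intro a
    apply le_antisymm
    · refine Finset.sup_le fun c _ => ?_
      rcases hcrisp a c with h | h
      · rw [h, one_mul]; exact hτmono a c h
      · rw [h, LMonoid.bot_mul]; exact bot_le
    · exact h_le_usup a (by simp [hrefl])
  · intro x a b
    have key : fcomp (fcomp E (fun p q => δα p x q)) E = fcomp (fun p q => δα p x q) E := by
      apply le_antisymm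
      · refine (h_mono (hrin x) le_rfl).trans ?_
        rw [h_assoc, h_idem hrefl htrans]
      · exact h_mono (h_le_refl_comp hrefl _) le_rfl
    rw [key]
    apply le_antisymm
    · refine (hδαQ _ x _).2 ?_
      rintro l ⟨v, hv, rfl⟩
      rw [hQ']
      exact hlow x a b v hv
    · refine Finset.sup_le fun c _ => ?_
      rcases hcrisp c b with h | h
      · rw [h, mul_one]
        refine (hδα a x c).2 ?_
        rintro l ⟨v, hv, rfl⟩
        refine le_trans ?_ ((hδαQ _ x _).1 ⟨v, hv, rfl⟩)
        rw [hQ']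
        exact h_mul_mono le_rfl (h_le_usup c (by simp [h]))
      · rw [h, LMonoid.mul_bot]; exact bot_le
  · intro a
    have e1 : fcompfR τα E a = τα a := by
      apply le_antisymm
      · refine Finset.sup_le fun c _ => ?_
        rw [hsymm c a]
        rcases hcrisp a c with h | h
        · rw [h, mul_one]; exact hτmono a c h
        · rw [h, LMonoid.mul_bot]; exact bot_le
      · exact h_le_usup a (by simp [hrefl])
    rw [e1]
    apply le_antisymm
    · refine (hταQ _).2 ?_
      rintro l ⟨w, rfl⟩
      refine le_trans ?_ ((hτα a).1 ⟨w, rfl⟩)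
      rw [h_qsup]
      refine Finset.sup_le fun b _ => ?_
      rw [hQ', hτQ]
      exact hDEτ _ _ a b
    · refine (hτα a).2 ?_
      rintro l ⟨w, rfl⟩
      refine le_trans ?_ ((hταQ _).1 ⟨w, rfl⟩)
      rw [h_qsup]
      refine Finset.sup_mono_fun fun b _ => ?_
      rw [hQ', hτQ]
      exact h_mul_mono (h_mul_mono le_rfl 
        (h_le_comp_refl hrefl (fun a b => dstar δ a (List.map Sum.inr w) b) a b)) le_rfl
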